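/- The ring C^ω[0,1] is a principal ideal domain: it is an integral domain in which every ideal is generated by a single element. -/

import Mathlib

/-- Extension of a function on `[0,1]` to `ℝ` by zero. -/
noncomputable def extIcc (f : Set.Icc (0:ℝ) 1 → ℝ) : ℝ → ℝ :=
  fun y => if h : y ∈ Set.Icc (0:ℝ) 1 then f ⟨y, h⟩ else 0

lemma extIcc_eq (f : Set.Icc (0:ℝ) 1 → ℝ) {y : ℝ} (h : y ∈ Set.Icc (0:ℝ) 1) :
    extIcc f y = f ⟨y, h⟩ := dif_pos h

/-- A function on `[0,1]` is real analytic on `[0,1]` if at every point of `[0,1]` it is given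
by a convergent power series on a neighborhood within `[0,1]` (one-sided at endpoints). -/
def IsAnalyticOnIcc (f : Set.Icc (0:ℝ) 1 → ℝ) : Prop :=
  ∀ x : Set.Icc (0:ℝ) 1, AnalyticWithinAt ℝ (extIcc f) (Set.Icc (0:ℝ) 1) x

lemma extIcc_add (f g : Set.Icc (0:ℝ) 1 → ℝ) : extIcc (f + g) = extIcc f + extIcc g := by
  funext y; by_cases h : y ∈ Set.Icc (0:ℝ) 1 <;> simp [extIcc, h]

lemma extIcc_mul (f g : Set.Icc (0:ℝ) 1 → ℝ) : extIcc (f * g) = extIcc f * extIcc g := by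
  funext y; by_cases h : y ∈ Set.Icc (0:ℝ) 1 <;> simp [extIcc, h]

lemma extIcc_neg (f : Set.Icc (0:ℝ) 1 → ℝ) : extIcc (-f) = -extIcc f := by
  funext y; by_cases h : y ∈ Set.Icc (0:ℝ) 1 <;> simp [extIcc, h]

/-- The ring `C^ω[0,1]` of real analytic functions on `[0,1]`, as a subring of the ring of all
functions `[0,1] → ℝ` with pointwise operations. -/
noncomputable def Comega : Subring (Set.Icc (0:ℝ) 1 → ℝ) where
  carrier := {f | IsAnalyticOnIcc f}
  zero_mem' := by
    intro x
    apply (analyticWithinAt_const (v := (0:ℝ))).congr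
    · intro y hy; simp [extIcc, hy]
    · simp [extIcc, x.2]
  one_mem' := by
    intro x
    apply (analyticWithinAt_const (v := (1:ℝ))).congr
    · intro y hy; simp [extIcc, hy]
    · simp [extIcc, x.2]
  add_mem' hf hg x := by rw [extIcc_add]; exact (hf x).add (hg x)
  mul_mem' hf hg x := by rw [extIcc_mul]; exact (hf x).mul (hg x)
  neg_mem' hf x := by rw [extIcc_neg]; exact (hf x).neg

/-- The ideal `M^ω_γ = {f ∈ C^ω[0,1] : f(γ) = 0}` of `C^ω[0,1]`. -/
noncomputable def Momega (γ : Set.Icc (0:ℝ) 1) : Ideal Comega where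
  carrier := {f | (f : Set.Icc (0:ℝ) 1 → ℝ) γ = 0}
  zero_mem' := rfl
  add_mem' := by
    intro a b ha hb
    simp only [Set.mem_setOf_eq] at *
    simp [ha, hb]
  smul_mem' := by
    intro c f hf
    simp only [Set.mem_setOf_eq, smul_eq_mul] at *
    simp [hf]

open Filter Topology

lemma isAnalyticOnIcc_iff {f : Set.Icc (0:ℝ) 1 → ℝ} :
    IsAnalyticOnIcc f ↔
      ∀ x : Set.Icc (0:ℝ) 1, ∃ g : ℝ → ℝ, AnalyticAt ℝ g x ∧ ∀ᶠ y in 𝓝 x, f y = g y := by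
  refine forall_congr' fun x => ?_
  rw [analyticWithinAt_iff_exists_analyticAt]
  refine exists_congr fun g => ?_
  rw [and_comm, Set.insert_eq_of_mem x.2]
  refine and_congr_right fun _ => ?_
  rw [EventuallyEq, ← map_nhds_subtype_val, eventually_map]
  exact eventually_congr (.of_forall fun y => by rw [extIcc_eq f y.2])

/-- Near each point, an analytic function either vanishes identically or is a power of the
distance coordinate times a nonvanishing analytic function. -/
lemma IsAnalyticOnIcc.eventually_eq_zero_or_eq_pow_mul {f : Set.Icc (0:ℝ) 1 → ℝ}
    (hf : IsAnalyticOnIcc f) (x : Set.Icc (0:ℝ) 1) :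
    (∀ᶠ y in 𝓝 x, f y = 0) ∨ ∃ (n : ℕ) (h : ℝ → ℝ), AnalyticAt ℝ h x ∧ h x ≠ 0 ∧
      ∀ᶠ y : Set.Icc (0:ℝ) 1 in 𝓝 x, f y = ((y : ℝ) - x) ^ n * h y := by
  obtain ⟨g, hg, hfg⟩ := isAnalyticOnIcc_iff.1 hf x
  by_cases h0 : ∀ᶠ z in 𝓝 (x : ℝ), g z = 0
  · left
    filter_upwards [hfg, continuous_subtype_val.continuousAt.eventually h0] with y h1 h2
    rw [h1, h2]
  · right
    obtain ⟨n, h, hh, hx, hgh⟩ := hg.exists_eventuallyEq_pow_smul_nonzero_iff.2 h0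
    refine ⟨n, h, hh, hx, ?_⟩
    filter_upwards [hfg, continuous_subtype_val.continuousAt.eventually hgh] with y h1 h2
    rw [h1, h2, smul_eq_mul]

lemma IsAnalyticOnIcc.eventually_eq_zero_or_eventually_ne_zero {f : Set.Icc (0:ℝ) 1 → ℝ}
    (hf : IsAnalyticOnIcc f) (x : Set.Icc (0:ℝ) 1) :
    (∀ᶠ y in 𝓝 x, f y = 0) ∨ ∀ᶠ y in 𝓝[≠] x, f y ≠ 0 := by
  refine (hf.eventually_eq_zero_or_eq_pow_mul x).imp_right ?_
  rintro ⟨n, h, hh, hx, hfh⟩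
  have hne : ∀ᶠ y : Set.Icc (0:ℝ) 1 in 𝓝 x, h y ≠ 0 :=
    continuous_subtype_val.continuousAt.eventually (hh.continuousAt.eventually_ne hx)
  filter_upwards [nhdsWithin_le_nhds hfh, nhdsWithin_le_nhds hne, self_mem_nhdsWithin]
    with y h1 h2 h3
  rw [h1]
  exact mul_ne_zero (pow_ne_zero _ (sub_ne_zero.2 fun h => h3 (Subtype.ext h))) h2

lemma IsAnalyticOnIcc.eventually_ne_zero {f : Set.Icc (0:ℝ) 1 → ℝ}
    (hf : IsAnalyticOnIcc f) (hf0 : f ≠ 0) (x : Set.Icc (0:ℝ) 1) :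
    ∀ᶠ y in 𝓝[≠] x, f y ≠ 0 := by
  refine (hf.eventually_eq_zero_or_eventually_ne_zero x).resolve_left fun hx => hf0 ?_
  have hclopen : IsClopen {z : Set.Icc (0:ℝ) 1 | ∀ᶠ y in 𝓝 z, f y = 0} := by
    refine ⟨⟨?_⟩, ?_⟩
    · rw [isOpen_iff_eventually]
      intro z hz
      have h := (hf.eventually_eq_zero_or_eventually_ne_zero z).resolve_left hz
      filter_upwards [eventually_nhdsWithin_iff.1 h] with y hy
      by_cases hyz : y = z
      · exact hyz ▸ hz
      · exact fun h0 => hy hyz h0.self_of_nhds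
    · rw [isOpen_iff_eventually]
      exact fun z hz => eventually_eventually_nhds.2 hz
  have huniv := hclopen.eq_univ ⟨x, hx⟩
  funext z
  have hz : ∀ᶠ y in 𝓝 z, f y = 0 := huniv.ge (Set.mem_univ z)
  exact hz.self_of_nhds

lemma IsAnalyticOnIcc.finite_zeros {f : Set.Icc (0:ℝ) 1 → ℝ}
    (hf : IsAnalyticOnIcc f) (hf0 : f ≠ 0) : {x | f x = 0}.Finite := by
  by_contra hinf
  obtain ⟨x, hx⟩ := Set.Infinite.exists_accPt_principal hinf
  rw [accPt_iff_frequently_nhdsNE] at hx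
  exact hx (hf.eventually_ne_zero hf0 x)

instance : IsDomain Comega := by
  have : NoZeroDivisors Comega := by
    refine ⟨fun {f g} hfg => ?_⟩
    by_contra! h
    have hf := f.2.finite_zeros fun h0 => h.1 (Subtype.ext h0)
    have hg := g.2.finite_zeros fun h0 => h.2 (Subtype.ext h0)
    have : Infinite (Set.Icc (0:ℝ) 1) := (Set.Icc_infinite one_pos).to_subtype
    refine Set.infinite_univ ((hf.union hg).subset fun x _ => ?_)
    exact mul_eq_zero.1 (congrFun (congrArg Subtype.val hfg) x)
  exact NoZeroDivisors.to_isDomain _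

/-- Restriction of polynomials to `[0,1]`. -/
noncomputable def Polynomial.toComega : Polynomial ℝ →+* Comega where
  toFun p := ⟨fun x => p.eval (x : ℝ), isAnalyticOnIcc_iff.2 fun x =>
    ⟨fun y => p.eval y, AnalyticOnNhd.eval_polynomial p x trivial, .of_forall fun _ => rfl⟩⟩
  map_one' := by ext; simp
  map_mul' _ _ := by ext; simp
  map_zero' := by ext; simp
  map_add' _ _ := by ext; simp

lemma Comega.isUnit_of_forall_ne_zero {f : Comega}
    (hf : ∀ x, (f : Set.Icc (0:ℝ) 1 → ℝ) x ≠ 0) : IsUnit f := by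
  refine IsUnit.of_mul_eq_one ⟨fun x => (f.1 x)⁻¹, isAnalyticOnIcc_iff.2 fun x => ?_⟩ ?_
  · obtain ⟨g, hg, hfg⟩ := isAnalyticOnIcc_iff.1 f.2 x
    refine ⟨g⁻¹, hg.inv (hfg.self_of_nhds ▸ hf x), ?_⟩
    filter_upwards [hfg] with y hy
    simp [hy]
  · ext x
    exact mul_inv_cancel₀ (hf x)

/-- A nonzero analytic function can be divided by the maximal power of `X - a`. -/
lemma Comega.exists_eq_pow_mul {f : Comega} (hf : f ≠ 0) (a : Set.Icc (0:ℝ) 1) :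
    ∃ (n : ℕ) (g : Comega), (g : Set.Icc (0:ℝ) 1 → ℝ) a ≠ 0 ∧
      f = ((Polynomial.X - Polynomial.C (a : ℝ)) ^ n).toComega * g := by
  obtain ⟨n, h, hh, ha, hfh⟩ := (f.2.eventually_eq_zero_or_eq_pow_mul a).resolve_left fun h0 => by
    have : Nontrivial (Set.Icc (0:ℝ) 1) := ⟨0, 1, zero_ne_one⟩
    obtain ⟨y, hy0, hy⟩ := ((h0.filter_mono nhdsWithin_le_nhds).and
      (f.2.eventually_ne_zero (fun h => hf (Subtype.ext h)) a)).exists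
    exact hy hy0
  let g : Set.Icc (0:ℝ) 1 → ℝ := fun x => if x = a then h a else f.1 x / ((x : ℝ) - a) ^ n
  have hsub {x : Set.Icc (0:ℝ) 1} (hx : x ≠ a) : ((x : ℝ) - a) ^ n ≠ 0 :=
    pow_ne_zero _ (sub_ne_zero.2 fun h => hx (Subtype.ext h))
  have hg : IsAnalyticOnIcc g := by
    refine isAnalyticOnIcc_iff.2 fun x => ?_
    by_cases hx : x = a
    · subst hx
      refine ⟨h, hh, ?_⟩
      filter_upwards [hfh] with y hy
      by_cases hyx : y = x
      · simp [g, hyx]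
      · simp only [g, if_neg hyx, hy]
        exact mul_div_cancel_left₀ _ (hsub hyx)
    · obtain ⟨k, hk, hfk⟩ := isAnalyticOnIcc_iff.1 f.2 x
      refine ⟨fun y => k y / (y - a) ^ n,
        hk.div ((analyticAt_id.sub analyticAt_const).pow n) (hsub hx), ?_⟩
      filter_upwards [hfk, eventually_ne_nhds hx] with y hy hya
      simp [g, hya, hy]
  refine ⟨n, ⟨g, hg⟩, by simpa [g] using ha, ?_⟩
  ext x
  by_cases hx : x = a
  · subst hx
    simpa [Polynomial.toComega, g] using hfh.self_of_nhds
  · simp [Polynomial.toComega, g, hx, mul_div_cancel₀ _ (hsub hx)]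

lemma Comega.exists_associated_toComega (f : Comega) :
    ∃ p : Polynomial ℝ, Associated p.toComega f := by
  by_cases hf : f = 0
  · exact ⟨0, by rw [hf, map_zero]⟩
  induction hn : {x | f.1 x = 0}.ncard using Nat.strong_induction_on generalizing f with
  | _ m ih =>
  have hfin := f.2.finite_zeros fun h => hf (Subtype.ext h)
  by_cases hz : ∃ a, f.1 a = 0
  · obtain ⟨a, ha⟩ := hz
    obtain ⟨n, g, hga, rfl⟩ := exists_eq_pow_mul hf a
    obtain ⟨p, hp⟩ := ih _ (hn ▸ Set.ncard_lt_ncard (t := {x | _ = (0 : ℝ)})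
      ⟨fun x hx => mul_eq_zero_of_right _ hx, fun hle => hga (hle ha)⟩ hfin)
      g (right_ne_zero_of_mul hf) rfl
    exact ⟨_ * p, by rw [map_mul]; exact hp.mul_left _⟩
  · push Not at hz
    exact ⟨1, by
      rw [map_one]; exact (associated_one_iff_isUnit.2 (isUnit_of_forall_ne_zero hz)).symm⟩

instance : IsPrincipalIdealRing Comega := by
  refine ⟨fun I => ?_⟩
  obtain ⟨q, hq⟩ := IsPrincipalIdealRing.principal (I.comap Polynomial.toComega)
  refine ⟨q.toComega, le_antisymm (fun f hf => ?_) ?_⟩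
  · obtain ⟨p, hp⟩ := Comega.exists_associated_toComega f
    have hpI : p ∈ I.comap Polynomial.toComega := I.mem_of_dvd hp.symm.dvd hf
    rw [hq] at hpI
    have hqp : q ∣ p := Ideal.mem_span_singleton.1 hpI
    exact Ideal.mem_span_singleton.2 ((map_dvd Polynomial.toComega hqp).trans hp.dvd)
  · refine (Ideal.span_singleton_le_iff_mem I).2 ?_
    have hqI : q ∈ I.comap Polynomial.toComega := hq ▸ Ideal.mem_span_singleton_self q
    exact hqI

/-- The ring C^ω[0,1] is a principal ideal domain: an integral domain in which
every ideal is generated by a single element. -/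
theorem Comega_isPrincipalIdealDomain :
    IsDomain Comega ∧ IsPrincipalIdealRing Comega :=
  ⟨inferInstance, inferInstance⟩
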